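/- arXiv:2412.10375 — 4 statements merged into one kernel-verified Lean document; each statement's English description precedes it below -/
import Mathlib

section
/- Let 𝔸 = (A₁, …, A_m) with A_i ∈ M_n(ℝ₊), and let B₁, …, B_m ∈ M_l(ℝ₊) be the principal submatrices of A₁, …, A_m obtained by selecting, in each A_i, the same rows and columns with indices i₁ < i₂ < … < i_l. Then for every 1 ≤ k ≤ l, W_max^k(𝔹) ⊆ W_max^k(𝔸), where 𝔹 = (B₁, …, B_m). -/
open Matrix

namespace MaxAlg

variable {I J K : Type*}

/-- Entrywise nonnegative matrix (matrix over `ℝ₊`). -/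
def Nonneg (A : Matrix I J ℝ) : Prop := ∀ i j, 0 ≤ A i j

/-- Max-algebra matrix product: `(A ⊗ B) i k = max_j (A i j * B j k)`. -/
noncomputable def maxMul [Fintype J] (A : Matrix I J ℝ) (B : Matrix J K ℝ) :
    Matrix I K ℝ :=
  Matrix.of fun i k => ⨆ j, A i j * B j k

/-- Max trace: `tr_⊗(M) = max_i M i i`. -/
noncomputable def maxTrace (M : Matrix I I ℝ) : ℝ := ⨆ i, M i i

/-- Max isometry: a nonnegative matrix `X` with `Xᵗ ⊗ X = I`. -/
def IsMaxIsometry [Fintype I] [Fintype J] [DecidableEq J] (X : Matrix I J ℝ) : Prop :=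
  Nonneg X ∧ maxMul Xᵀ X = 1

/-- Max numerical range `W_max(A) = {xᵗ⊗A⊗x : x ∈ ℝ₊ⁿ, xᵗ⊗x = 1}`,
vectors being treated as `n × 1` matrices. -/
noncomputable def WMax [Fintype I] (A : Matrix I I ℝ) : Set ℝ :=
  {r | ∃ x : Matrix I (Fin 1) ℝ, Nonneg x ∧ maxMul xᵀ x = 1 ∧
    r = maxMul xᵀ (maxMul A x) 0 0}

/-- Max rank-`k` numerical range
`Λ_k^max(A) = {λ ∈ ℝ₊ : Xᵗ⊗A⊗X = λ I_k for some max isometry X}`. -/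
noncomputable def LambdaMax [Fintype I] (k : ℕ) (A : Matrix I I ℝ) : Set ℝ :=
  {lam | 0 ≤ lam ∧ ∃ X : Matrix I (Fin k) ℝ, IsMaxIsometry X ∧
    maxMul Xᵀ (maxMul A X) = lam • (1 : Matrix (Fin k) (Fin k) ℝ)}

/-- Max `k`-numerical range `W_max^k(A) = {tr_⊗(Xᵗ⊗A⊗X) : X ∈ 𝒳_{n×k}}`. -/
noncomputable def WMaxK [Fintype I] (k : ℕ) (A : Matrix I I ℝ) : Set ℝ :=
  {r | ∃ X : Matrix I (Fin k) ℝ, IsMaxIsometry X ∧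
    r = maxTrace (maxMul Xᵀ (maxMul A X))}

/-- Max joint `k`-numerical range of an `m`-tuple of matrices. -/
noncomputable def WMaxKJoint [Fintype I] {m : ℕ} (k : ℕ)
    (A : Fin m → Matrix I I ℝ) : Set (Fin m → ℝ) :=
  {v | ∃ X : Matrix I (Fin k) ℝ, IsMaxIsometry X ∧
    ∀ l, v l = maxTrace (maxMul Xᵀ (maxMul (A l) X))}

/-- Sup-norm of a real matrix: maximum absolute value of an entry. -/
noncomputable def matNorm (M : Matrix I J ℝ) : ℝ := ⨆ i, ⨆ j, |M i j|

/-- Sup-norm of a real vector: maximum absolute value of an entry. -/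
noncomputable def vecNorm (v : I → ℝ) : ℝ := ⨆ i, |v i|

/-- Entrywise maximum (`max sum`) of two matrices. -/
def maxAdd (A B : Matrix I J ℝ) : Matrix I J ℝ :=
  Matrix.of fun i j => max (A i j) (B i j)

/-- Max joint `c`-numerical range of an `m`-tuple of matrices:
`{(max_i c_i (xᵢᵗ⊗A₁⊗xᵢ), …) : X = [x₁,…,xₙ] max unitary}`; note that
`xᵢᵗ⊗A⊗xᵢ` is the `(i,i)` entry of `Xᵗ⊗A⊗X`. -/
noncomputable def WMaxCJoint {n m : ℕ} (c : Fin n → ℝ)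
    (A : Fin m → Matrix (Fin n) (Fin n) ℝ) : Set (Fin m → ℝ) :=
  {v | ∃ U : Matrix (Fin n) (Fin n) ℝ, IsMaxIsometry U ∧
    ∀ l, v l = ⨆ i, c i * maxMul Uᵀ (maxMul (A l) U) i i}

/-- Max joint `C`-numerical range of an `m`-tuple of matrices:
`{(tr_⊗(C⊗Xᵗ⊗A₁⊗X), …) : X max unitary}`. -/
noncomputable def WMaxBigCJoint {n m : ℕ} (C : Matrix (Fin n) (Fin n) ℝ)
    (A : Fin m → Matrix (Fin n) (Fin n) ℝ) : Set (Fin m → ℝ) :=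
  {v | ∃ X : Matrix (Fin n) (Fin n) ℝ, IsMaxIsometry X ∧
    ∀ l, v l = maxTrace (maxMul C (maxMul Xᵀ (maxMul (A l) X)))}

/-- A nonnegative family vanishing off the range of `f` has the same supremum after
reindexing along `f`. -/
theorem iSup_eq_iSup_comp [Finite I] [Finite J] (f : I → J) (g : J → ℝ)
    (hg : ∀ j, 0 ≤ g j) (hgf : ∀ j, j ∉ Set.range f → g j = 0) :
    ⨆ j, g j = ⨆ i, g (f i) := by
  apply le_antisymm
  · refine Real.iSup_le (fun j => ?_) (Real.iSup_nonneg fun i => hg (f i))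
    by_cases hj : j ∈ Set.range f
    · obtain ⟨i, rfl⟩ := hj
      exact le_ciSup (f := fun i => g (f i)) (Set.finite_range _).bddAbove i
    · rw [hgf j hj]
      exact Real.iSup_nonneg fun i => hg (f i)
  · exact Real.iSup_le (fun i => le_ciSup (Set.finite_range g).bddAbove (f i))
      (Real.iSup_nonneg hg)

theorem Nonneg.maxMul [Fintype J] {A : Matrix I J ℝ} {B : Matrix J K ℝ}
    (hA : Nonneg A) (hB : Nonneg B) : Nonneg (maxMul A B) :=
  fun i k => Real.iSup_nonneg fun j => mul_nonneg (hA i j) (hB j k)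

/-- Place the rows of `X` at the indices given by `f`, with zero rows elsewhere. -/
noncomputable def extendRows (f : I → J) (X : Matrix I K ℝ) : Matrix J K ℝ :=
  Matrix.of (Function.extend f X (0 : J → K → ℝ))

theorem extendRows_apply {f : I → J} (hf : Function.Injective f) (X : Matrix I K ℝ) (i : I) :
    extendRows f X (f i) = X i :=
  hf.extend_apply X (0 : J → K → ℝ) i

theorem extendRows_of_notMem_range {f : I → J} (X : Matrix I K ℝ) {j : J}
    (hj : j ∉ Set.range f) : extendRows f X j = 0 :=
  Function.extend_apply' X (0 : J → K → ℝ) j hj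

theorem Nonneg.extendRows {f : I → J} (hf : Function.Injective f) {X : Matrix I K ℝ}
    (hX : Nonneg X) : Nonneg (extendRows f X) := by
  intro j k
  by_cases hj : j ∈ Set.range f
  · obtain ⟨i, rfl⟩ := hj
    rw [extendRows_apply hf]
    exact hX i k
  · rw [extendRows_of_notMem_range X hj, Pi.zero_apply]

theorem maxMul_extendRows {L : Type*} [Fintype I] [Fintype J] {f : I → J}
    (hf : Function.Injective f) {A : Matrix L J ℝ} {X : Matrix I K ℝ}
    (hA : Nonneg A) (hX : Nonneg X) :
    maxMul A (extendRows f X) = maxMul (A.submatrix id f) X := by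
  ext a k
  refine (iSup_eq_iSup_comp f (fun j => A a j * extendRows f X j k)
    (fun j => mul_nonneg (hA a j) (hX.extendRows hf j k)) fun j hj => ?_).trans ?_
  · simp [extendRows_of_notMem_range X hj]
  · simp only [extendRows_apply hf]
    rfl

theorem maxMul_transpose_extendRows {L : Type*} [Fintype I] [Fintype J] {f : I → J}
    (hf : Function.Injective f) {C : Matrix J L ℝ} {X : Matrix I K ℝ}
    (hC : Nonneg C) (hX : Nonneg X) :
    maxMul (extendRows f X)ᵀ C = maxMul Xᵀ (C.submatrix f id) := by
  ext k b
  refine (iSup_eq_iSup_comp f (fun j => extendRows f X j k * C j b)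
    (fun j => mul_nonneg (hX.extendRows hf j k) (hC j b)) fun j hj => ?_).trans ?_
  · simp [extendRows_of_notMem_range X hj]
  · simp only [extendRows_apply hf]
    rfl

theorem IsMaxIsometry.extendRows [Fintype I] [Fintype J] [Fintype K] [DecidableEq K]
    {f : I → J} (hf : Function.Injective f) {X : Matrix I K ℝ} (hX : IsMaxIsometry X) :
    IsMaxIsometry (extendRows f X) := by
  have hrows : (MaxAlg.extendRows f X).submatrix f id = X := by
    ext i k
    exact congrFun (extendRows_apply hf X i) k
  refine ⟨hX.1.extendRows hf, ?_⟩
  rw [maxMul_transpose_extendRows hf (hX.1.extendRows hf) hX.1, hrows, hX.2]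

/-- for principal submatrices `B_l = (A_l).submatrix f f` taken with the
same index set in every `A_l`, `W_max^k(𝔹) ⊆ W_max^k(𝔸)` for `1 ≤ k ≤ p`. -/
theorem wmaxKJoint_submatrix_subset {n p m : ℕ}
    (A : Fin m → Matrix (Fin n) (Fin n) ℝ) (hA : ∀ l, Nonneg (A l))
    (f : Fin p → Fin n) (hf : StrictMono f)
    {k : ℕ} (hk1 : 1 ≤ k) (hkp : k ≤ p) :
    WMaxKJoint k (fun l => (A l).submatrix f f) ⊆ WMaxKJoint k A := by
  rintro v ⟨X, hX, hv⟩
  refine ⟨extendRows f X, hX.extendRows hf.injective, fun l => ?_⟩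
  rw [hv l, maxMul_transpose_extendRows hf.injective
    ((hA l).maxMul (hX.1.extendRows hf.injective)) hX.1,
    maxMul_extendRows hf.injective (hA l) hX.1]
  rfl

end MaxAlg
end

section
/- Let 𝔸 = (A₁, …, A_m) with A_i ∈ M_n(ℝ₊) for i = 1, …, m, and let k be an integer with m − 1 < k < n. Then W_max^{k+1}(𝔸) ⊆ W_max^k(𝔸). -/
open Matrix

namespace MaxAlg

variable {I J K : Type*}

lemma IsMaxIsometry.submatrix [Fintype I] [Fintype J] [DecidableEq J] [Fintype K] [DecidableEq K]
    {X : Matrix I J ℝ} (hX : IsMaxIsometry X) {f : K → J} (hf : Function.Injective f) :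
    IsMaxIsometry (X.submatrix id f) := by
  refine ⟨fun i j => hX.1 i (f j), ?_⟩
  have h : maxMul (X.submatrix id f)ᵀ (X.submatrix id f) = (maxMul Xᵀ X).submatrix f f := rfl
  rw [h, hX.2, Matrix.submatrix_one f hf]

lemma maxTrace_submatrix_eq [Finite I] {M : Matrix I I ℝ} {f : J → I} {j : J}
    (hj : M (f j) (f j) = maxTrace M) : maxTrace (M.submatrix f f) = maxTrace M := by
  have hle (i : J) : M (f i) (f i) ≤ maxTrace M :=
    le_ciSup (f := fun i => M i i) (Set.finite_range _).bddAbove (f i)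
  have : Nonempty J := ⟨j⟩
  refine le_antisymm (ciSup_le hle) ?_
  rw [← hj]
  refine le_ciSup (f := fun i => M (f i) (f i)) ⟨maxTrace M, ?_⟩ j
  rintro _ ⟨i, rfl⟩
  exact hle i

/-- if `m − 1 < k < n` (i.e. `m ≤ k < n`), then
`W_max^{k+1}(𝔸) ⊆ W_max^k(𝔸)`. -/
theorem wmaxKJoint_succ_subset {n m : ℕ} (hm : 0 < m)
    (A : Fin m → Matrix (Fin n) (Fin n) ℝ) (hA : ∀ l, Nonneg (A l))
    {k : ℕ} (hmk : m ≤ k) (hkn : k < n) :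
    WMaxKJoint (k + 1) A ⊆ WMaxKJoint k A := by
  rintro v ⟨X, hX, hv⟩
  have hmax (l : Fin m) : ∃ i, maxMul Xᵀ (maxMul (A l) X) i i =
      maxTrace (maxMul Xᵀ (maxMul (A l) X)) :=
    exists_eq_ciSup_of_finite (f := fun i => maxMul Xᵀ (maxMul (A l) X) i i)
  choose c hc using hmax
  obtain ⟨p, hp⟩ : ∃ p, ∀ l, c l ≠ p := by
    by_contra! h
    have := Fintype.card_le_of_surjective c h
    simp only [Fintype.card_fin] at this
    lia
  refine ⟨X.submatrix id p.succAbove, hX.submatrix p.succAbove_right_injective, fun l => ?_⟩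
  obtain ⟨j, hj⟩ := Fin.exists_succAbove_eq (hp l)
  rw [hv l]
  exact (maxTrace_submatrix_eq (f := p.succAbove) (j := j) (by rw [hj, hc l])).symm

end MaxAlg
end

section
/- Let 𝔸 = (A₁, …, A_m) with A_l ∈ M_n(ℝ₊) for l = 1, …, m, and let c = [c₁, …, c_n]ᵗ ∈ ℝ₊ⁿ. Then W_max^c(𝔸) = { ( max_{1≤i≤n} c_i (A₁)_{σ(i)σ(i)}, …, max_{1≤i≤n} c_i (A_m)_{σ(i)σ(i)} ) : σ ∈ S_n }, where S_n is the symmetric group on n letters. -/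
open Matrix

namespace MaxAlg

variable {I J K : Type*}

/-- A finite supremum of a function vanishing away from `a` and nonnegative at `a` is its value
at `a`. -/
theorem ciSup_eq_of_eq_zero [Finite I] {f : I → ℝ} (a : I) (ha : 0 ≤ f a)
    (h : ∀ i, i ≠ a → f i = 0) : ⨆ i, f i = f a := by
  have : Nonempty I := ⟨a⟩
  refine le_antisymm (ciSup_le fun i => ?_) (le_ciSup (Set.finite_range f).bddAbove a)
  by_cases hi : i = a
  · rw [hi]
  · rw [h i hi]
    exact ha

/-- The `0`-`1` matrix whose column `j` has its unique nonzero entry in row `f j`. -/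
def columnMatrix [DecidableEq I] (f : J → I) : Matrix I J ℝ :=
  Matrix.of fun i j => if i = f j then 1 else 0

theorem columnMatrix_apply [DecidableEq I] (f : J → I) (i : I) (j : J) :
    columnMatrix f i j = if i = f j then 1 else 0 := rfl

theorem nonneg_columnMatrix [DecidableEq I] (f : J → I) : Nonneg (columnMatrix f) := by
  intro i j
  rw [columnMatrix_apply]
  split_ifs <;> norm_num

theorem maxMul_transpose_columnMatrix [Fintype I] [DecidableEq I] (f : J → I)
    {M : Matrix I K ℝ} (hM : Nonneg M) (j : J) (k : K) :
    maxMul (columnMatrix f)ᵀ M j k = M (f j) k := by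
  have h := ciSup_eq_of_eq_zero (f := fun i => columnMatrix f i j * M i k) (f j)
    (mul_nonneg (nonneg_columnMatrix f _ _) (hM _ _))
    (fun i hi => by simp [columnMatrix_apply, hi])
  simpa [maxMul, columnMatrix_apply] using h

theorem maxMul_columnMatrix [Fintype I] [DecidableEq I] (f : J → I)
    {M : Matrix K I ℝ} (hM : Nonneg M) (k : K) (j : J) :
    maxMul M (columnMatrix f) k j = M k (f j) := by
  have h := ciSup_eq_of_eq_zero (f := fun i => M k i * columnMatrix f i j) (f j)
    (mul_nonneg (hM _ _) (nonneg_columnMatrix f _ _))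
    (fun i hi => by simp [columnMatrix_apply, hi])
  simpa [maxMul, columnMatrix_apply] using h

theorem maxMul_transpose_maxMul_columnMatrix [Fintype I] [DecidableEq I] (f : J → I)
    {M : Matrix I I ℝ} (hM : Nonneg M) (j k : J) :
    maxMul (columnMatrix f)ᵀ (maxMul M (columnMatrix f)) j k = M (f j) (f k) := by
  have h : Nonneg (maxMul M (columnMatrix f)) := fun i l => by
    rw [maxMul_columnMatrix f hM]
    exact hM _ _
  rw [maxMul_transpose_columnMatrix f h, maxMul_columnMatrix f hM]

theorem isMaxIsometry_columnMatrix [Fintype I] [DecidableEq I] [Fintype J] [DecidableEq J]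
    {f : J → I} (hf : Function.Injective f) : IsMaxIsometry (columnMatrix f) := by
  refine ⟨nonneg_columnMatrix f, ?_⟩
  ext j k
  rw [maxMul_transpose_columnMatrix f (nonneg_columnMatrix f), columnMatrix_apply,
    Matrix.one_apply]
  simp only [hf.eq_iff]

/-- Square max isometries are permutation matrices. -/
theorem IsMaxIsometry.exists_eq_columnMatrix [Fintype I] [DecidableEq I]
    {U : Matrix I I ℝ} (hU : IsMaxIsometry U) :
    ∃ σ : Equiv.Perm I, U = columnMatrix σ := by
  obtain ⟨hU0, hU1⟩ := hU
  have hsup (j k : I) : ⨆ i, U i j * U i k = (1 : Matrix I I ℝ) j k := congrFun₂ hU1 j k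
  have horth (i j k : I) (hjk : j ≠ k) : U i j * U i k = 0 := by
    refine le_antisymm ?_ (mul_nonneg (hU0 _ _) (hU0 _ _))
    rw [← Matrix.one_apply_ne (α := ℝ) hjk, ← hsup j k]
    exact le_ciSup (f := fun i => U i j * U i k) (Set.finite_range _).bddAbove i
  have hone (j : I) : ∃ i, U i j = 1 := by
    have : Nonempty I := ⟨j⟩
    obtain ⟨i, hi⟩ := exists_eq_ciSup_of_finite (f := fun i => U i j * U i j)
    refine ⟨i, ?_⟩
    rw [hsup, Matrix.one_apply_eq] at hi
    nlinarith [hU0 i j]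
  choose f hf using hone
  have hinj : Function.Injective f := by
    intro j k hjk
    by_contra hne
    have h := horth (f j) j k hne
    rw [hf j, hjk, hf k] at h
    norm_num at h
  have hbij : Function.Bijective f := Finite.injective_iff_bijective.mp hinj
  refine ⟨Equiv.ofBijective f hbij, ?_⟩
  ext i k
  obtain ⟨j, rfl⟩ := hbij.surjective i
  rw [columnMatrix_apply, Equiv.ofBijective_apply]
  by_cases hjk : j = k
  · rw [hjk, if_pos rfl, hf k]
  · rw [if_neg (hinj.ne hjk)]
    simpa [hf j] using horth (f j) j k hjk

/-- the max joint `c`-numerical range equals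
`{(max_i c_i (A₁)_{σ(i)σ(i)}, …, max_i c_i (A_m)_{σ(i)σ(i)}) : σ ∈ S_n}`. -/
theorem wmaxCJoint_eq_perm {n m : ℕ} (hn : 0 < n)
    (c : Fin n → ℝ) (hc : ∀ i, 0 ≤ c i)
    (A : Fin m → Matrix (Fin n) (Fin n) ℝ) (hA : ∀ l, Nonneg (A l)) :
    WMaxCJoint c A =
      {v | ∃ σ : Equiv.Perm (Fin n), ∀ l, v l = ⨆ i, c i * A l (σ i) (σ i)} := by
  ext v
  constructor
  · rintro ⟨U, hU, hv⟩
    obtain ⟨σ, rfl⟩ := hU.exists_eq_columnMatrix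
    refine ⟨σ, fun l => ?_⟩
    simpa only [maxMul_transpose_maxMul_columnMatrix _ (hA l)] using hv l
  · rintro ⟨σ, hv⟩
    refine ⟨columnMatrix σ, isMaxIsometry_columnMatrix σ.injective, fun l => ?_⟩
    simpa only [maxMul_transpose_maxMul_columnMatrix _ (hA l)] using hv l

end MaxAlg
end

section
/- Let 𝔸 = (A₁, …, A_m) with A_i ∈ M_n(ℝ₊) for i = 1, …, m, let C ∈ M_n(ℝ₊), and let V ∈ 𝒰_n be a max unitary matrix. Then W_max^{Vᵗ⊗C⊗V}(𝔸) = W_max^{C}(𝔸). -/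
open Matrix

namespace MaxAlg

variable {I J K : Type*}

section Permutation

open Equiv


theorem maxMul_apply_of_forall_ne [Fintype J] {A : Matrix I J ℝ} {B : Matrix J K ℝ} {i : I} {k : K}
    (j : J) (hj : 0 ≤ A i j * B j k) (h : ∀ j', j' ≠ j → A i j' * B j' k = 0) :
    maxMul A B i k = A i j * B j k := by
  have : Nonempty J := ⟨j⟩
  refine le_antisymm (ciSup_le fun j' => ?_)
    (le_ciSup (f := fun j' => A i j' * B j' k) (Set.finite_range _).bddAbove j)
  by_cases hjj : j' = j
  · rw [hjj]
  · rwa [h j' hjj]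

theorem maxMul_one_submatrix [Fintype J] [DecidableEq J] {A : Matrix I J ℝ} (hA : Nonneg A)
    (σ : K → J) : maxMul A ((1 : Matrix J J ℝ).submatrix id σ) = A.submatrix id σ := by
  ext i k
  rw [maxMul_apply_of_forall_ne (σ k)]
  · simp [one_apply]
  · simpa [one_apply] using hA i (σ k)
  · intro j hj
    simp [one_apply, hj]

theorem one_submatrix_transpose_maxMul [Fintype J] [DecidableEq J] {B : Matrix J K ℝ}
    (hB : Nonneg B) (σ : I → J) :
    maxMul ((1 : Matrix J J ℝ).submatrix id σ)ᵀ B = B.submatrix σ id := by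
  ext i k
  rw [maxMul_apply_of_forall_ne (σ i)]
  · simp [one_apply]
  · simpa [one_apply] using hB (σ i) k
  · intro j hj
    simp [one_apply, hj]

theorem maxMul_conj_one_submatrix [Fintype J] [DecidableEq J] {A : Matrix J J ℝ} (hA : Nonneg A)
    (σ : I → J) :
    maxMul ((1 : Matrix J J ℝ).submatrix id σ)ᵀ (maxMul A ((1 : Matrix J J ℝ).submatrix id σ)) =
      A.submatrix σ σ := by
  rw [maxMul_one_submatrix hA, one_submatrix_transpose_maxMul (B := A.submatrix id σ) fun i j => hA _ _]
  rfl

theorem isMaxIsometry_one_submatrix [Fintype I] [DecidableEq I] (σ : Perm I) :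
    IsMaxIsometry ((1 : Matrix I I ℝ).submatrix id σ) := by
  have h : Nonneg ((1 : Matrix I I ℝ).submatrix id σ) := fun i j => by
    simp only [submatrix_apply, one_apply]
    split_ifs <;> norm_num
  refine ⟨h, ?_⟩
  rw [one_submatrix_transpose_maxMul h]
  exact submatrix_one_equiv σ

/-- A square max isometry is a permutation matrix. -/
theorem IsMaxIsometry.exists_perm [Fintype I] [DecidableEq I] {X : Matrix I I ℝ}
    (hX : IsMaxIsometry X) : ∃ σ : Perm I, X = (1 : Matrix I I ℝ).submatrix id σ := by
  obtain ⟨hnn, hX⟩ := hX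
  have hentry : ∀ j k, ⨆ i, X i j * X i k = (1 : Matrix I I ℝ) j k := fun j k => congrFun₂ hX j k
  have hcol : ∀ j, ∃ i, X i j = 1 := fun j => by
    have : Nonempty I := ⟨j⟩
    obtain ⟨i, hi⟩ := exists_eq_ciSup_of_finite (f := fun i => X i j * X i j)
    rw [hentry, one_apply_eq] at hi
    exact ⟨i, by nlinarith [hnn i j]⟩
  choose σ hσ using hcol
  have hzero : ∀ j k, j ≠ k → X (σ j) k = 0 := fun j k hjk => by
    have h := le_ciSup (f := fun i => X i j * X i k) (Set.finite_range _).bddAbove (σ j)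
    rw [hentry, one_apply_ne hjk] at h
    simp only [hσ, one_mul] at h
    exact le_antisymm h (hnn _ _)
  have hinj : Function.Injective σ := fun j k hjk => by
    by_contra hne
    have h := hzero j k hne
    rw [hjk, hσ] at h
    exact one_ne_zero h
  refine ⟨ofBijective σ (Finite.injective_iff_bijective.mp hinj), ?_⟩
  ext i k
  obtain ⟨j, rfl⟩ := Finite.injective_iff_surjective.mp hinj i
  by_cases hjk : j = k
  · simp [one_apply, hjk, hσ]
  · simp [one_apply, hzero j k hjk, hinj.ne hjk]

end Permutation

theorem mem_WMaxBigCJoint_iff {n m : ℕ} (C : Matrix (Fin n) (Fin n) ℝ)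
    {A : Fin m → Matrix (Fin n) (Fin n) ℝ} (hA : ∀ l, Nonneg (A l)) (v : Fin m → ℝ) :
    v ∈ WMaxBigCJoint C A ↔
      ∃ σ : Equiv.Perm (Fin n), ∀ l, v l = ⨆ i, ⨆ j, C i j * A l (σ j) (σ i) := by
  constructor
  · rintro ⟨X, hX, hv⟩
    obtain ⟨σ, rfl⟩ := hX.exists_perm
    refine ⟨σ, fun l => ?_⟩
    rw [hv, maxMul_conj_one_submatrix (hA l)]
    rfl
  · rintro ⟨σ, hv⟩
    refine ⟨_, isMaxIsometry_one_submatrix σ, fun l => ?_⟩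
    rw [hv, maxMul_conj_one_submatrix (hA l)]
    rfl

/-- for a max unitary `V`,
`W_max^{Vᵗ⊗C⊗V}(𝔸) = W_max^C(𝔸)`. -/
theorem wmaxBigCJoint_conj_unitary {n m : ℕ}
    (C : Matrix (Fin n) (Fin n) ℝ) (hC : Nonneg C)
    (A : Fin m → Matrix (Fin n) (Fin n) ℝ) (hA : ∀ l, Nonneg (A l))
    (V : Matrix (Fin n) (Fin n) ℝ) (hV : IsMaxIsometry V) :
    WMaxBigCJoint (maxMul Vᵀ (maxMul C V)) A = WMaxBigCJoint C A := by
  obtain ⟨τ, rfl⟩ := hV.exists_perm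
  rw [maxMul_conj_one_submatrix hC]
  have hreindex : ∀ (σ : Equiv.Perm (Fin n)) l,
      ⨆ i, ⨆ j, C.submatrix τ τ i j * A l (σ (τ j)) (σ (τ i)) =
        ⨆ i, ⨆ j, C i j * A l (σ j) (σ i) := fun σ l => by
    rw [← τ.iSup_comp (g := fun i => ⨆ j, C i j * A l (σ j) (σ i))]
    exact iSup_congr fun i => τ.iSup_comp (g := fun j => C (τ i) j * A l (σ j) (σ (τ i)))
  ext v
  rw [mem_WMaxBigCJoint_iff _ hA, mem_WMaxBigCJoint_iff _ hA,
    ← (Equiv.mulRight τ).exists_congr_right]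
  simp only [Equiv.coe_mulRight, Equiv.Perm.mul_apply, hreindex]

end MaxAlg
end
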